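/- Suppose R is a Gram–de Finetti matrix satisfying the Ghirlanda–Guerra identities, with R_{l,l} = 1 and P(R_{1,2} = q_l) = m_{l+1} − m_l for 1 ≤ l ≤ k, where −1 ≤ q_1 < q_2 < ⋯ < q_k ≤ 1 and 0 = m_1 < m_2 < ⋯ < m_k < m_{k+1} = 1 (no sign assumption on q_1). Then P(R_{1,2} ≥ 0) = 1; equivalently, q_1 ≥ 0. -/

import Mathlib

open MeasureTheory ProbabilityTheory

noncomputable section

/-- The space of infinite real matrices. -/
abbrev Mat := ℕ → ℕ → ℝ

/-- The strictly upper-triangular part of the top-left `n × n` submatrix. -/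
def subU (n : ℕ) (M : Mat) : {p : Fin n × Fin n // p.1 < p.2} → ℝ :=
  fun p => M p.1.1 p.1.2

/-- `R` is a Gram–de Finetti matrix under `P`: measurable, entries in `[-1,1]`,
symmetric, a.s. every finite submatrix positive semidefinite, and weakly
exchangeable. -/
def IsGramDeFinetti {Ω : Type*} [MeasurableSpace Ω] (P : Measure Ω) (R : Ω → Mat) : Prop :=
  Measurable R ∧
  (∀ᵐ ω ∂P, ∀ i j, R ω i j ∈ Set.Icc (-1 : ℝ) 1) ∧
  (∀ᵐ ω ∂P, ∀ i j, R ω i j = R ω j i) ∧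
  (∀ᵐ ω ∂P, ∀ (n : ℕ) (c : Fin n → ℝ),
    0 ≤ ∑ i : Fin n, ∑ j : Fin n, c i * c j * R ω i j) ∧
  (∀ (n : ℕ) (ρ : Equiv.Perm (Fin n)),
    Measure.map (fun ω => fun i j : Fin n => R ω (ρ i) (ρ j)) P
      = Measure.map (fun ω => fun i j : Fin n => R ω i j) P)

/-- `R` satisfies the Ghirlanda–Guerra identities under `P`. -/
def SatisfiesGGI {Ω : Type*} [MeasurableSpace Ω] (P : Measure Ω) (R : Ω → Mat) : Prop :=
  ∀ (n : ℕ), 2 ≤ n → ∀ (f : ({p : Fin n × Fin n // p.1 < p.2} → ℝ) → ℝ),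
    Measurable f → (∃ C, ∀ x, |f x| ≤ C) →
    ∀ (ψ : ℝ → ℝ), Measurable ψ → (∃ C, ∀ x, |ψ x| ≤ C) →
    ∫ ω, f (subU n (R ω)) * ψ (R ω 0 n) ∂P
      = (1 / n) * (∫ ω, f (subU n (R ω)) ∂P) * (∫ ω, ψ (R ω 0 1) ∂P)
        + (1 / n) * ∑ l ∈ Finset.Ico 1 n, ∫ ω, f (subU n (R ω)) * ψ (R ω 0 l) ∂P

/-- The finite-value condition: ones on the diagonal, and the off-diagonal entries
take values `q 1 < ⋯ < q k` with probabilities `m (l+1) - m l`, where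
`-1 ≤ q 1` (no sign assumption), `q k ≤ 1`, `0 = m 1 < ⋯ < m k < m (k+1) = 1`. -/
def FiniteValueCondition {Ω : Type*} [MeasurableSpace Ω] (P : Measure Ω) (R : Ω → Mat)
    (k : ℕ) (q m : ℕ → ℝ) : Prop :=
  (∀ᵐ ω ∂P, ∀ l, R ω l l = 1) ∧
  (∀ l, 1 ≤ l → l < k → q l < q (l + 1)) ∧ (-1 ≤ q 1) ∧ (q k ≤ 1) ∧
  (m 1 = 0) ∧ (m (k + 1) = 1) ∧ (∀ l, 1 ≤ l → l ≤ k → m l < m (l + 1)) ∧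
  (∀ l, 1 ≤ l → l ≤ k →
    P {ω | R ω 0 1 = q l} = ENNReal.ofReal (m (l + 1) - m l))

/-- The event that all off-diagonal entries of the top-left `n × n` block are at most `c`. -/
def offDiagLE {Ω : Type*} (R : Ω → Mat) (c : ℝ) (n : ℕ) : Set Ω :=
  {ω | ∀ i < n, ∀ j < n, i ≠ j → R ω i j ≤ c}

lemma measurable_entry {Ω : Type*} [MeasurableSpace Ω] {R : Ω → Mat} (hR : Measurable R)
    (i j : ℕ) : Measurable fun ω => R ω i j :=
  (measurable_pi_apply j).comp ((measurable_pi_apply i).comp hR)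

lemma measurableSet_offDiagLE {Ω : Type*} [MeasurableSpace Ω] {R : Ω → Mat}
    (hR : Measurable R) (c : ℝ) (n : ℕ) : MeasurableSet (offDiagLE R c n) := by
  have h : offDiagLE R c n = ⋂ i, ⋂ (_ : i < n), ⋂ j, ⋂ (_ : j < n), ⋂ (_ : i ≠ j),
      {ω | R ω i j ≤ c} := by
    ext ω
    simp [offDiagLE]
  rw [h]
  exact .iInter fun i => .iInter fun _ => .iInter fun j => .iInter fun _ => .iInter fun _ =>
    measurableSet_le (measurable_entry hR i j) measurable_const

/-- By weak exchangeability the row used to compare with a new column is irrelevant. -/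
lemma IsGramDeFinetti.measureReal_offDiagLE_inter_lt {Ω : Type*} [MeasurableSpace Ω]
    {P : Measure Ω} {R : Ω → Mat} (hR : IsGramDeFinetti P R) (c : ℝ) {n l : ℕ} (hl : l < n) :
    P.real (offDiagLE R c n ∩ {ω | c < R ω l n})
      = P.real (offDiagLE R c n ∩ {ω | c < R ω 0 n}) := by
  obtain ⟨hm, -, -, -, hex⟩ := hR
  let B : Set (Fin (n + 1) → Fin (n + 1) → ℝ) :=
    {M | (∀ i j, i ≠ j → i ≠ Fin.last n → j ≠ Fin.last n → M i j ≤ c) ∧ c < M 0 (Fin.last n)}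
  have hB : MeasurableSet B := by
    have h : B = (⋂ i, ⋂ j, ⋂ (_ : i ≠ j), ⋂ (_ : i ≠ Fin.last n), ⋂ (_ : j ≠ Fin.last n),
        {M : Fin (n + 1) → Fin (n + 1) → ℝ | M i j ≤ c}) ∩ {M | c < M 0 (Fin.last n)} := by
      ext M
      simp [B]
    rw [h]
    refine .inter (.iInter fun i => .iInter fun j => .iInter fun _ => .iInter fun _ =>
      .iInter fun _ => measurableSet_le ?_ measurable_const)
      (measurableSet_lt measurable_const ?_)
    all_goals fun_prop
  have hmρ (ρ : Equiv.Perm (Fin (n + 1))) :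
      Measurable fun ω => fun i j : Fin (n + 1) => R ω (ρ i) (ρ j) :=
    measurable_pi_lambda _ fun i => measurable_pi_lambda _ fun j => measurable_entry hm _ _
  let l' : Fin (n + 1) := ⟨l, by omega⟩
  let ρ := Equiv.swap 0 l'
  have h0 : (0 : Fin (n + 1)) ≠ Fin.last n := by
    intro h
    have := congrArg Fin.val h
    simp at this
    omega
  have hl' : l' ≠ Fin.last n := by
    intro h
    have := congrArg Fin.val h
    simp [l'] at this
    omega
  have hρ : ρ (Fin.last n) = Fin.last n :=
    Equiv.swap_apply_of_ne_of_ne h0.symm hl'.symm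
  have key (σ : Equiv.Perm (Fin (n + 1))) (hσ : σ (Fin.last n) = Fin.last n) :
      (fun ω => fun i j : Fin (n + 1) => R ω (σ i) (σ j)) ⁻¹' B
        = offDiagLE R c n ∩ {ω | c < R ω (σ 0) n} := by
    ext ω
    have hne (i : Fin (n + 1)) : i ≠ Fin.last n ↔ (i : ℕ) < n := by
      rw [Ne, Fin.ext_iff, Fin.val_last]
      omega
    simp only [Set.mem_preimage, Set.mem_ofPred_eq, B, Set.mem_inter_iff, offDiagLE, hσ,
      Fin.val_last]
    refine and_congr_left fun _ => ⟨fun h i hi j hj hij => ?_, fun h i j hij hi hj => ?_⟩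
    · have hs (a : Fin (n + 1)) (ha : (a : ℕ) < n) : σ.symm a ≠ Fin.last n := fun h =>
        (hne a).2 ha (by rw [← hσ, ← h, Equiv.apply_symm_apply])
      simpa using h (σ.symm ⟨i, by omega⟩) (σ.symm ⟨j, by omega⟩)
        (by simpa [Fin.ext_iff] using hij) (hs _ hi) (hs _ hj)
    · have hs (a : Fin (n + 1)) (ha : a ≠ Fin.last n) : (σ a : ℕ) < n :=
        (hne _).1 fun h => ha (σ.injective (h.trans hσ.symm))
      exact h _ (hs i hi) _ (hs j hj) fun h => hij (σ.injective (Fin.ext h))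
  have h1 := key ρ hρ
  have h2 := key 1 rfl
  have h3 : (ρ 0 : ℕ) = l := by simp [ρ, l']
  rw [h3] at h1
  have e := congrArg (fun μ => μ B) ((hex (n + 1) ρ).trans (hex (n + 1) 1).symm)
  beta_reduce at e
  rw [Measure.map_apply (hmρ ρ) hB, Measure.map_apply (hmρ 1) hB, h1, h2] at e
  simpa [Measure.real] using congrArg ENNReal.toReal e

lemma SatisfiesGGI.measureReal_offDiagLE_inter_lt {Ω : Type*} [MeasurableSpace Ω]
    {P : Measure Ω} {R : Ω → Mat} (hG : IsGramDeFinetti P R)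
    (hR : SatisfiesGGI P R) (c : ℝ) {n : ℕ} (hn : 2 ≤ n) :
    P.real (offDiagLE R c n ∩ {ω | c < R ω 0 n})
      = (1 / n) * P.real (offDiagLE R c n) * P.real {ω | c < R ω 0 1} := by
  obtain ⟨hm, -, hsymm, -, -⟩ := hG
  let S : Set ({p : Fin n × Fin n // p.1 < p.2} → ℝ) := {x | ∀ p, x p ≤ c}
  have hS : MeasurableSet S := by
    have h : S = ⋂ p, {x | x p ≤ c} := by
      ext x
      simp [S]
    rw [h]
    exact .iInter fun p => measurableSet_le (measurable_pi_apply p) measurable_const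
  have hbound {α : Type _} (s : Set α) : ∃ C : ℝ, ∀ x, |s.indicator 1 x| ≤ C :=
    ⟨1, fun x => by by_cases hx : x ∈ s <;> simp [hx]⟩
  have hA : MeasurableSet (offDiagLE R c n) := measurableSet_offDiagLE hm c n
  have hlt (l : ℕ) : MeasurableSet {ω | c < R ω 0 l} :=
    measurableSet_lt measurable_const (measurable_entry hm 0 l)
  have hf : ∀ᵐ ω ∂P, S.indicator (1 : ({p : Fin n × Fin n // p.1 < p.2} → ℝ) → ℝ) (subU n (R ω))
      = (offDiagLE R c n).indicator 1 ω := by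
    filter_upwards [hsymm] with ω hω
    have h : subU n (R ω) ∈ S ↔ ω ∈ offDiagLE R c n := by
      simp only [S, subU, offDiagLE, Set.mem_ofPred_eq]
      refine ⟨fun h i hi j hj hij => ?_, fun h p => ?_⟩
      · rcases lt_or_gt_of_ne hij with hij | hij
        · exact h ⟨(⟨i, hi⟩, ⟨j, hj⟩), hij⟩
        · rw [hω]
          exact h ⟨(⟨j, hj⟩, ⟨i, hi⟩), hij⟩
      · exact h _ p.1.1.2 _ p.1.2.2 (Nat.ne_of_lt p.2)
    by_cases hx : ω ∈ offDiagLE R c n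
    · simp [hx, h.2 hx]
    · simp [hx, mt h.1 hx]
  have hprod (l : ℕ) : ∫ ω, S.indicator 1 (subU n (R ω)) * (Set.Ioi c).indicator 1 (R ω 0 l) ∂P
      = P.real (offDiagLE R c n ∩ {ω | c < R ω 0 l}) := by
    rw [← integral_indicator_one (hA.inter (hlt l))]
    refine integral_congr_ae ?_
    filter_upwards [hf] with ω hω
    rw [hω, Set.inter_indicator_one]
    rfl
  have hzero : ∀ l ∈ Finset.Ico 1 n,
      ∫ ω, S.indicator 1 (subU n (R ω)) * (Set.Ioi c).indicator 1 (R ω 0 l) ∂P = (0 : ℝ) := by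
    intro l hl
    rw [Finset.mem_Ico] at hl
    have he : offDiagLE R c n ∩ {ω | c < R ω 0 l} = ∅ := by
      refine Set.eq_empty_of_forall_notMem fun ω hω => ?_
      exact absurd (hω.1 0 (by omega) l hl.2 (by omega)) (not_le.2 hω.2)
    rw [hprod, he, measureReal_empty]
  have h := hR n hn (S.indicator 1) (measurable_one.indicator hS) (hbound S)
    ((Set.Ioi c).indicator 1) (measurable_one.indicator measurableSet_Ioi) (hbound _)
  rw [Finset.sum_eq_zero hzero, hprod, integral_congr_ae hf, integral_indicator_one hA,
    mul_zero, add_zero] at h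
  rw [h, ← integral_indicator_one (hlt 1)]
  rfl

lemma SatisfiesGGI.mul_measureReal_offDiagLE_le_succ {Ω : Type*} [MeasurableSpace Ω]
    {P : Measure Ω} [IsProbabilityMeasure P] {R : Ω → Mat} (hG : IsGramDeFinetti P R)
    (hR : SatisfiesGGI P R) (c : ℝ) {n : ℕ} (hn : 2 ≤ n) :
    P.real {ω | R ω 0 1 ≤ c} * P.real (offDiagLE R c n) ≤ P.real (offDiagLE R c (n + 1)) := by
  have hsub : ∀ᵐ ω ∂P, ω ∈ offDiagLE R c n → ω ∈ offDiagLE R c (n + 1) ∪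
      ⋃ l ∈ Finset.range n, offDiagLE R c n ∩ {ω | c < R ω l n} := by
    filter_upwards [hG.2.2.1] with ω hω h
    by_cases hx : ∃ l < n, c < R ω l n
    · obtain ⟨l, hl, hlc⟩ := hx
      refine Or.inr ?_
      simp only [Set.mem_iUnion, Finset.mem_range]
      exact ⟨l, hl, h, hlc⟩
    · push Not at hx
      refine Or.inl fun i hi j hj hij => ?_
      rcases Nat.lt_succ_iff_lt_or_eq.1 hi with hi | rfl
      · rcases Nat.lt_succ_iff_lt_or_eq.1 hj with hj | rfl
        · exact h i hi j hj hij
        · exact hx i hi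
      · rw [hω]
        exact hx j (by omega)
  have h1 : P.real (offDiagLE R c n) ≤ P.real (offDiagLE R c (n + 1)) +
      ∑ l ∈ Finset.range n, P.real (offDiagLE R c n ∩ {ω | c < R ω l n}) :=
    (ENNReal.toReal_mono (measure_ne_top _ _) (measure_mono_ae hsub)).trans
      ((measureReal_union_le _ _).trans
        (add_le_add_right (measureReal_biUnion_finset_le _ _) _))
  rw [Finset.sum_congr rfl fun l hl =>
    (hG.measureReal_offDiagLE_inter_lt c (Finset.mem_range.1 hl)).trans
      (hR.measureReal_offDiagLE_inter_lt hG c hn), Finset.sum_const, Finset.card_range,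
    nsmul_eq_mul] at h1
  have h2 : P.real {ω | c < R ω 0 1} = 1 - P.real {ω | R ω 0 1 ≤ c} := by
    rw [← probReal_compl_eq_one_sub
      (measurableSet_le (measurable_entry hG.1 0 1) measurable_const)]
    congr 1
    ext ω
    simp
  have hn0 : (n : ℝ) ≠ 0 := by
    have : n ≠ 0 := by omega
    exact_mod_cast this
  have h3 : (n : ℝ) * (1 / n * P.real (offDiagLE R c n) * P.real {ω | c < R ω 0 1})
      = P.real (offDiagLE R c n) * (1 - P.real {ω | R ω 0 1 ≤ c}) := by
    rw [h2]
    field_simp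
  rw [h3] at h1
  linarith

lemma SatisfiesGGI.measureReal_offDiagLE_pos {Ω : Type*} [MeasurableSpace Ω]
    {P : Measure Ω} [IsProbabilityMeasure P] {R : Ω → Mat} (hG : IsGramDeFinetti P R)
    (hR : SatisfiesGGI P R) {c : ℝ} (hc : 0 < P.real {ω | R ω 0 1 ≤ c}) {n : ℕ} (hn : 2 ≤ n) :
    0 < P.real (offDiagLE R c n) := by
  induction n, hn using Nat.le_induction with
  | base =>
    refine hc.trans_le (ENNReal.toReal_mono (measure_ne_top _ _) (measure_mono_ae ?_))
    filter_upwards [hG.2.2.1] with ω hω (h : R ω 0 1 ≤ c) i hi j hj hij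
    have hij' : i = 0 ∧ j = 1 ∨ i = 1 ∧ j = 0 := by omega
    rcases hij' with ⟨rfl, rfl⟩ | ⟨rfl, rfl⟩
    · exact h
    · rwa [hω]
  | succ n hn ih =>
    exact (mul_pos hc ih).trans_le (hR.mul_measureReal_offDiagLE_le_succ hG c hn)

/-- Large Gram matrices cannot have all off-diagonal entries below a negative constant. -/
lemma IsGramDeFinetti.exists_measureReal_offDiagLE_eq_zero {Ω : Type*} [MeasurableSpace Ω]
    {P : Measure Ω} {R : Ω → Mat} (hG : IsGramDeFinetti P R) {c : ℝ} (hc : c < 0) :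
    ∃ n, 2 ≤ n ∧ P.real (offDiagLE R c n) = 0 := by
  obtain ⟨-, hIcc, -, hpsd, -⟩ := hG
  obtain ⟨N, hN⟩ := exists_nat_gt (1 / (-c))
  rw [div_lt_iff₀ (by linarith)] at hN
  refine ⟨N + 2, by omega, ?_⟩
  have h0 : P (offDiagLE R c (N + 2)) = 0 := by
    rw [measure_eq_zero_iff_ae_notMem]
    filter_upwards [hIcc, hpsd] with ω hb hp hω
    have hp := hp (N + 2) fun _ => 1
    have hrow (i : Fin (N + 2)) : ∑ j : Fin (N + 2), 1 * 1 * R ω i j ≤ 1 + (N + 1) * c := by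
      rw [← Finset.add_sum_erase _ _ (Finset.mem_univ i)]
      have hs : ∑ j ∈ Finset.univ.erase i, 1 * 1 * R ω i j
          ≤ ∑ j ∈ Finset.univ.erase i, c := by
        refine Finset.sum_le_sum fun j hj => ?_
        rw [one_mul, one_mul]
        exact hω i i.2 j j.2 fun h => (Finset.mem_erase.1 hj).1 (Fin.ext h.symm)
      rw [Finset.sum_const, Finset.card_erase_of_mem (Finset.mem_univ i), Finset.card_univ,
        Fintype.card_fin, nsmul_eq_mul] at hs
      push_cast at hs
      have := (hb i i).2
      linarith
    have htot := Finset.sum_le_sum fun i (_ : i ∈ Finset.univ) => hrow i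
    rw [Finset.sum_const, Finset.card_univ, Fintype.card_fin, nsmul_eq_mul] at htot
    have hneg : ((N + 2 : ℕ) : ℝ) * (1 + (N + 1) * c) < 0 :=
      mul_neg_of_pos_of_neg (by positivity) (by nlinarith)
    linarith
  simp [Measure.real, h0]

lemma SatisfiesGGI.measure_le_eq_zero_of_neg {Ω : Type*} [MeasurableSpace Ω]
    {P : Measure Ω} [IsProbabilityMeasure P] {R : Ω → Mat} (hG : IsGramDeFinetti P R)
    (hR : SatisfiesGGI P R) {c : ℝ} (hc : c < 0) : P {ω | R ω 0 1 ≤ c} = 0 := by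
  rw [← measureReal_eq_zero_iff]
  by_contra hne
  obtain ⟨n, hn, h0⟩ := hG.exists_measureReal_offDiagLE_eq_zero hc
  exact (hR.measureReal_offDiagLE_pos hG (lt_of_le_of_ne measureReal_nonneg (Ne.symm hne))
    hn).ne' h0

/-- Talagrand's positivity principle in this setting: for a Gram–de Finetti
matrix satisfying the Ghirlanda–Guerra identities and the finite-value condition
with no sign assumption on `q 1`, the overlap is nonnegative:
`P(R_{1,2} ≥ 0) = 1` (equivalently `q 1 ≥ 0`). -/
theorem positivity_principle {Ω : Type*} [MeasurableSpace Ω] (P : Measure Ω)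
    [IsProbabilityMeasure P] (R : Ω → Mat) (k : ℕ) (hk : 1 ≤ k) (q m : ℕ → ℝ)
    (hGdF : IsGramDeFinetti P R) (hGGI : SatisfiesGGI P R)
    (hFV : FiniteValueCondition P R k q m) :
    P {ω | 0 ≤ R ω 0 1} = 1 ∧ 0 ≤ q 1 := by
  constructor
  · have h : ∀ᵐ ω ∂P, ∀ n : ℕ, -(1 / ((n : ℝ) + 1)) < R ω 0 1 := by
      refine ae_all_iff.2 fun n => ?_
      have := hGGI.measure_le_eq_zero_of_neg hGdF
        (neg_neg_of_pos (Nat.one_div_pos_of_nat (α := ℝ) (n := n)))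
      filter_upwards [measure_eq_zero_iff_ae_notMem.1 this] with ω hω
      exact not_le.1 hω
    rw [← mem_ae_iff_prob_eq_one
      (measurableSet_le measurable_const (measurable_entry hGdF.1 0 1))]
    filter_upwards [h] with ω hω
    by_contra hneg
    obtain ⟨n, hn⟩ := exists_nat_one_div_lt (neg_pos.2 (not_le.1 hneg))
    linarith [hω n]
  · by_contra hneg
    obtain ⟨-, -, -, -, -, -, hm, hq⟩ := hFV
    have h0 : P {ω | R ω 0 1 = q 1} = 0 :=
      measure_mono_null (fun ω (hω : R ω 0 1 = q 1) => hω.le)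
        (hGGI.measure_le_eq_zero_of_neg hGdF (not_le.1 hneg))
    rw [hq 1 le_rfl hk, ENNReal.ofReal_eq_zero] at h0
    linarith [hm 1 le_rfl hk]

end
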